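/- Let H be either T8, T11, or a 4-Ore graph with T(H) = 3, and let f be an edge of H. Then either T(H − f) = T(H) or H − f contains a subgraph isomorphic to K4 minus an edge. -/

import Mathlib

open SimpleGraph

/-- A graph is 4-critical if it is not 3-colorable but every proper subgraph is 3-colorable. -/
def FourCritical {V : Type*} (G : SimpleGraph V) : Prop :=
  ¬ G.Colorable 3 ∧ ∀ H : SimpleGraph V, H < G → H.Colorable 3

/-- `S` is the vertex set of a cycle of length at most four in `G`. -/
def ShortCycleSet {V : Type*} (G : SimpleGraph V) (S : Set V) : Prop :=
  ∃ (v : V) (w : G.Walk v v), w.IsCycle ∧ w.length ≤ 4 ∧ {x | x ∈ w.support} = S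

/-- `maxTri G` (the quantity `T(G)` of the paper) is the maximum number of pairwise
vertex-disjoint cycles of length at most four in `G`. -/
noncomputable def maxTri {V : Type*} (G : SimpleGraph V) : ℕ :=
  sSup {n | ∃ C : Finset (Set V), C.card = n ∧ (∀ S ∈ C, ShortCycleSet G S) ∧
    (C : Set (Set V)).Pairwise Disjoint}

/-- The potential `p(G) = 5|V(G)| - 3|E(G)| - T(G)`. -/
noncomputable def pot {V : Type*} (G : SimpleGraph V) : ℤ :=
  5 * (Nat.card V : ℤ) - 3 * (Nat.card G.edgeSet : ℤ) - (maxTri G : ℤ)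

/-- The graph obtained by the Ore composition of `G₁` (edge side, replaced edge `xy`) and
`G₂` (split side, split vertex `z`, with `A` the set of neighbours of `z` assigned to the
copy `z₁` identified with `x`). -/
def oreGraph {V₁ V₂ : Type*} (G₁ : SimpleGraph V₁) (x y : V₁) (G₂ : SimpleGraph V₂)
    (z : V₂) (A : Set V₂) : SimpleGraph (V₁ ⊕ {v : V₂ // v ≠ z}) :=
  SimpleGraph.fromRel (fun a b =>
    match a, b with
    | Sum.inl a, Sum.inl b => G₁.Adj a b ∧ ¬(a = x ∧ b = y) ∧ ¬(a = y ∧ b = x)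
    | Sum.inr a, Sum.inr b => G₂.Adj a.1 b.1
    | Sum.inl a, Sum.inr b => G₂.Adj z b.1 ∧ ((a = x ∧ b.1 ∈ A) ∨ (a = y ∧ b.1 ∉ A))
    | Sum.inr _, Sum.inl _ => False)

/-- `H` is an Ore composition of `G₁` and `G₂`: an edge `xy` of `G₁` is deleted, a vertex `z`
of `G₂` is split into two vertices of positive degree, which are identified with `x` and `y`. -/
def IsOreComposition {V₁ V₂ V₃ : Type*} (H : SimpleGraph V₃) (G₁ : SimpleGraph V₁)
    (G₂ : SimpleGraph V₂) : Prop :=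
  ∃ (x y : V₁) (z : V₂) (A : Set V₂), G₁.Adj x y ∧
    (A ∩ G₂.neighborSet z).Nonempty ∧ ((G₂.neighborSet z) \ A).Nonempty ∧
    Nonempty (H ≃g oreGraph G₁ x y G₂ z A)

/-- The 4-Ore graphs on vertex sets `Fin n`: obtained from copies of `K₄` by
repeated Ore compositions. -/
inductive FourOreAux : ∀ {n : ℕ}, SimpleGraph (Fin n) → Prop
  | k4 : FourOreAux (⊤ : SimpleGraph (Fin 4))
  | ore {n₁ n₂ n : ℕ} {G₁ : SimpleGraph (Fin n₁)} {G₂ : SimpleGraph (Fin n₂)}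
      {G : SimpleGraph (Fin n)} :
      FourOreAux G₁ → FourOreAux G₂ → IsOreComposition G G₁ G₂ → FourOreAux G

/-- A graph is 4-Ore if it is isomorphic to a 4-Ore graph on some `Fin n`. -/
def IsFourOre {V : Type*} (H : SimpleGraph V) : Prop :=
  ∃ (n : ℕ) (G : SimpleGraph (Fin n)), FourOreAux G ∧ Nonempty (H ≃g G)

/-- `G` contains `K₄` minus an edge as a subgraph (vertices `a,b` of degree three in it). -/
def HasK4MinusE {V : Type*} (G : SimpleGraph V) : Prop :=
  ∃ a b c d : V, a ≠ b ∧ a ≠ c ∧ a ≠ d ∧ b ≠ c ∧ b ≠ d ∧ c ≠ d ∧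
    G.Adj a b ∧ G.Adj a c ∧ G.Adj a d ∧ G.Adj b c ∧ G.Adj b d

/-- `a,b,c,d` form a diamond of `H`: a subgraph isomorphic to `K₄ - e` (with `a,b` its
degree-three vertices) such that `a` and `b` also have degree three in `H`. -/
def IsDiamond {V : Type*} (H : SimpleGraph V) (a b c d : V) : Prop :=
  a ≠ b ∧ a ≠ c ∧ a ≠ d ∧ b ≠ c ∧ b ≠ d ∧ c ≠ d ∧
  H.Adj a b ∧ H.Adj a c ∧ H.Adj a d ∧ H.Adj b c ∧ H.Adj b d ∧
  (H.neighborSet a).ncard = 3 ∧ (H.neighborSet b).ncard = 3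

/-- Splitting the vertex `v` of `G` into two vertices `Sum.inr 0` and `Sum.inr 1`, the
neighbours of `v` in `A` going to the first and the remaining neighbours to the second. -/
def splitGraph {V : Type*} (G : SimpleGraph V) (v : V) (A : Set V) :
    SimpleGraph ({u : V // u ≠ v} ⊕ Fin 2) :=
  SimpleGraph.fromRel (fun a b =>
    match a, b with
    | Sum.inl a, Sum.inl b => G.Adj a.1 b.1
    | Sum.inl a, Sum.inr i => G.Adj v a.1 ∧ ((i = 0 ∧ a.1 ∈ A) ∨ (i = 1 ∧ a.1 ∉ A))
    | _, _ => False)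

/-- The graph `T₈` of the paper. -/
def T8 : SimpleGraph (Fin 8) :=
  SimpleGraph.fromRel (fun a b => (a, b) ∈
    ([(0,1),(1,2),(2,0),(0,3),(3,6),(6,7),(7,3),(2,4),(4,6),(6,5),(5,1),(4,7),(7,5)] :
      List (Fin 8 × Fin 8)))

/-- The graph `T₁₁` of the paper. -/
def T11 : SimpleGraph (Fin 11) :=
  SimpleGraph.fromRel (fun a b => (a, b) ∈
    ([(0,8),(8,10),(10,9),(9,1),(8,9),(10,1),(1,2),(2,0),(0,3),(3,6),(6,7),(7,3),
      (2,4),(4,6),(6,5),(5,1),(4,7),(7,5)] : List (Fin 11 × Fin 11)))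

/-- The wheel `W₅`: a 5-cycle `0,…,4` together with a hub `5` adjacent to all of it. -/
def W5 : SimpleGraph (Fin 6) :=
  SimpleGraph.fromRel (fun a b => (a, b) ∈
    ([(0,1),(1,2),(2,3),(3,4),(4,0),(5,0),(5,1),(5,2),(5,3),(5,4)] : List (Fin 6 × Fin 6)))

/-- The exceptional 4-critical graphs: `K₄`, `H₇` (the 4-Ore graph on seven vertices),
`W₅`, `T₈`, `T₁₁`, and the 4-Ore graphs with `T = 3`. -/
def Exceptional {V : Type*} (G : SimpleGraph V) : Prop :=
  Nonempty (G ≃g (⊤ : SimpleGraph (Fin 4))) ∨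
  (∃ H₇ : SimpleGraph (Fin 7), IsFourOre H₇ ∧ Nonempty (G ≃g H₇)) ∨
  Nonempty (G ≃g W5) ∨ Nonempty (G ≃g T8) ∨ Nonempty (G ≃g T11) ∨
  (IsFourOre G ∧ maxTri G = 3)

/-- `G` is a minimum counterexample to the main theorem: a 4-critical graph with
`p(G) ≥ -1` which is not exceptional, such that every 4-critical graph on fewer vertices
satisfies the conclusion of the main theorem. -/
def MinCounterexample {V : Type*} (G : SimpleGraph V) : Prop :=
  FourCritical G ∧ -1 ≤ pot G ∧ ¬ Exceptional G ∧
  ∀ m : ℕ, m < Nat.card V → ∀ H : SimpleGraph (Fin m), FourCritical H →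
    Exceptional H ∨ pot H ≤ -2

/-- The φ-identification `G_φ(R)`: the color classes of `R` are identified to the three
vertices `Sum.inr i`, which form a triangle. -/
def identGraph {V : Type*} (G : SimpleGraph V) (R : Set V) (φ : V → Fin 3) :
    SimpleGraph ({v : V // v ∉ R} ⊕ Fin 3) :=
  SimpleGraph.fromRel (fun a b =>
    match a, b with
    | Sum.inl a, Sum.inl b => G.Adj a.1 b.1
    | Sum.inl a, Sum.inr i => ∃ r ∈ R, φ r = i ∧ G.Adj a.1 r
    | Sum.inr _, Sum.inr _ => True
    | Sum.inr _, Sum.inl _ => False)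

/-- `S` is the vertex set of a triangle or of a (not necessarily induced) 4-cycle of `G`. -/
def TriOrQuad {V : Type*} (G : SimpleGraph V) (S : Set V) : Prop :=
  (∃ a b c, G.Adj a b ∧ G.Adj b c ∧ G.Adj c a ∧ S = {a, b, c}) ∨
  ∃ a b c d, a ≠ c ∧ b ≠ d ∧ G.Adj a b ∧ G.Adj b c ∧ G.Adj c d ∧ G.Adj d a ∧ S = {a, b, c, d}

section ShortCycles

variable {V W : Type*} {G G' : SimpleGraph V} {G₂ : SimpleGraph W} {S T U : Set V}

theorem TriOrQuad.nonempty (h : TriOrQuad G S) : S.Nonempty := by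
  rcases h with ⟨a, b, c, -, -, -, rfl⟩ | ⟨a, b, c, d, -, -, -, -, -, -, rfl⟩ <;>
    exact ⟨a, by simp⟩

theorem TriOrQuad.shortCycleSet (h : TriOrQuad G S) : ShortCycleSet G S := by
  rcases h with ⟨a, b, c, hab, hbc, hca, rfl⟩ | ⟨a, b, c, d, hac, hbd, hab, hbc, hcd, hda, rfl⟩
  · refine ⟨a, .cons hab (.cons hbc (.cons hca .nil)), ?_, by simp, ?_⟩
    · have h₁ := hab.ne
      have h₂ := hbc.ne
      have h₃ := hca.ne
      simp [Walk.cons_isCycle_iff, Walk.cons_isPath_iff]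
      grind
    · ext x; simp; tauto
  · refine ⟨a, .cons hab (.cons hbc (.cons hcd (.cons hda .nil))), ?_, by simp, ?_⟩
    · have h₁ := hab.ne
      have h₂ := hbc.ne
      have h₃ := hcd.ne
      have h₄ := hda.ne
      simp [Walk.cons_isCycle_iff, Walk.cons_isPath_iff]
      grind
    · ext x; simp; tauto

theorem TriOrQuad.image (h : TriOrQuad G S) {f : V → W} (hf : f.Injective)
    (hadj : ∀ a ∈ S, ∀ b ∈ S, G.Adj a b → G₂.Adj (f a) (f b)) : TriOrQuad G₂ (f '' S) := by
  rcases h with ⟨a, b, c, hab, hbc, hca, rfl⟩ | ⟨a, b, c, d, hac, hbd, hab, hbc, hcd, hda, rfl⟩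
  · refine .inl ⟨f a, f b, f c, ?_, ?_, ?_, by simp [Set.image_insert_eq]⟩ <;>
      apply hadj <;> simp [*]
  · refine .inr ⟨f a, f b, f c, f d, hf.ne hac, hf.ne hbd, ?_, ?_, ?_, ?_,
      by simp [Set.image_insert_eq]⟩ <;> apply hadj <;> simp [*]

theorem TriOrQuad.deleteEdges (h : TriOrQuad G S) {u : V} (hu : u ∉ S) (v : V) :
    TriOrQuad (G.deleteEdges {s(u, v)}) S := by
  have := h.image (f := id) (G₂ := G.deleteEdges {s(u, v)}) Function.injective_id ?_
  · simpa using this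
  · intro a ha b hb hab
    simp only [id, deleteEdges_adj, Set.mem_singleton_iff, Sym2.eq_iff]
    grind

theorem SimpleGraph.Iso.deleteEdges_adj_symm {V W : Type*} {G : SimpleGraph V}
    {G' : SimpleGraph W} (φ : G ≃g G') {u v : V} {a b : W}
    (hab : (G'.deleteEdges {s(φ u, φ v)}).Adj a b) :
    (G.deleteEdges {s(u, v)}).Adj (φ.symm a) (φ.symm b) := by
  simp only [deleteEdges_adj, Set.mem_singleton_iff, Sym2.eq_iff] at hab ⊢
  refine ⟨φ.symm.map_adj_iff.2 hab.1, fun h => hab.2 ?_⟩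
  rcases h with ⟨rfl, rfl⟩ | ⟨rfl, rfl⟩ <;> simp

theorem HasK4MinusE.map (h : HasK4MinusE G) {f : V → W} (hf : f.Injective)
    (hadj : ∀ a b, G.Adj a b → G₂.Adj (f a) (f b)) : HasK4MinusE G₂ := by
  obtain ⟨a, b, c, d, h₁, h₂, h₃, h₄, h₅, h₆, h₇, h₈, h₉, h₁₀, h₁₁⟩ := h
  exact ⟨f a, f b, f c, f d, hf.ne h₁, hf.ne h₂, hf.ne h₃, hf.ne h₄, hf.ne h₅, hf.ne h₆,
    hadj _ _ h₇, hadj _ _ h₈, hadj _ _ h₉, hadj _ _ h₁₀, hadj _ _ h₁₁⟩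

theorem HasK4MinusE.exists_triOrQuad_deleteEdges (h : HasK4MinusE G) (u v : V) :
    ∃ S, TriOrQuad (G.deleteEdges {s(u, v)}) S := by
  obtain ⟨a, b, c, d, h₁, h₂, h₃, h₄, h₅, h₆, h₇, h₈, h₉, h₁₀, h₁₁⟩ := h
  by_cases hab : s(a, b) = s(u, v)
  · refine ⟨_, .inr ⟨a, c, b, d, h₁, h₆, ?_, ?_, ?_, ?_, rfl⟩⟩ <;>
      simp only [deleteEdges_adj, Set.mem_singleton_iff, Sym2.eq_iff] at * <;>
      grind [SimpleGraph.adj_comm]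
  by_cases hc : s(a, c) = s(u, v) ∨ s(b, c) = s(u, v)
  · refine ⟨_, .inl ⟨a, b, d, ?_, ?_, ?_, rfl⟩⟩ <;>
      simp only [deleteEdges_adj, Set.mem_singleton_iff, Sym2.eq_iff] at * <;>
      grind [SimpleGraph.adj_comm]
  · refine ⟨_, .inl ⟨a, b, c, ?_, ?_, ?_, rfl⟩⟩ <;>
      simp only [deleteEdges_adj, Set.mem_singleton_iff, Sym2.eq_iff] at * <;>
      grind [SimpleGraph.adj_comm]

theorem ShortCycleSet.mono (h : ShortCycleSet G S) (hG : G ≤ G') : ShortCycleSet G' S := by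
  obtain ⟨v, w, hw, hl, rfl⟩ := h
  exact ⟨v, w.mapLe hG, hw.mapLe hG, by simpa using hl, by simp⟩

theorem ShortCycleSet.three_le_ncard [Finite V] (h : ShortCycleSet G S) : 3 ≤ S.ncard := by
  classical
  obtain ⟨v, w, hw, -, rfl⟩ := h
  have h₁ : w.support.tail.toFinset.card = w.length := by
    rw [List.toFinset_card_of_nodup hw.support_nodup]; simp
  have h₂ := hw.three_le_length
  rw [← h₁, ← Set.ncard_coe_finset] at h₂
  refine h₂.trans (Set.ncard_le_ncard ?_ (Set.toFinite _))
  intro x hx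
  exact List.mem_of_mem_tail (by simpa using hx)

variable [Finite V]

theorem three_mul_card_le_of_shortCycleSet {C : Finset (Set V)}
    (hC : ∀ S ∈ C, ShortCycleSet G S) (hd : (C : Set (Set V)).Pairwise Disjoint) :
    3 * C.card ≤ Nat.card V := by
  classical
  have := Fintype.ofFinite V
  have h₁ : (C.biUnion fun S => S.toFinset).card = ∑ S ∈ C, S.toFinset.card :=
    Finset.card_biUnion fun S hS T hT hST => by simpa using hd hS hT hST
  have h₂ : C.card • 3 ≤ ∑ S ∈ C, S.toFinset.card :=
    Finset.card_nsmul_le_sum _ _ _ fun S hS => by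
      rw [← Set.ncard_eq_toFinset_card']
      exact (hC S hS).three_le_ncard
  have h₃ := Finset.card_le_univ (C.biUnion fun S => S.toFinset)
  rw [Nat.card_eq_fintype_card]
  simp only [smul_eq_mul] at h₂
  omega

theorem card_le_maxTri {C : Finset (Set V)} (hC : ∀ S ∈ C, ShortCycleSet G S)
    (hd : (C : Set (Set V)).Pairwise Disjoint) : C.card ≤ maxTri G := by
  refine le_csSup ⟨Nat.card V, ?_⟩ ⟨C, rfl, hC, hd⟩
  rintro n ⟨D, rfl, hD, hDd⟩
  have := three_mul_card_le_of_shortCycleSet hD hDd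
  omega

theorem exists_card_eq_maxTri (G : SimpleGraph V) : ∃ C : Finset (Set V), C.card = maxTri G ∧
    (∀ S ∈ C, ShortCycleSet G S) ∧ (C : Set (Set V)).Pairwise Disjoint := by
  refine Nat.sSup_mem (s := {n | ∃ C : Finset (Set V), C.card = n ∧
    (∀ S ∈ C, ShortCycleSet G S) ∧ (C : Set (Set V)).Pairwise Disjoint})
    ⟨0, ∅, by simp⟩ ⟨Nat.card V, ?_⟩
  rintro n ⟨D, rfl, hD, hDd⟩
  have := three_mul_card_le_of_shortCycleSet hD hDd
  omega

theorem maxTri_mono (hG : G ≤ G') : maxTri G ≤ maxTri G' := by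
  obtain ⟨C, hc, hC, hd⟩ := exists_card_eq_maxTri G
  rw [← hc]
  exact card_le_maxTri (fun S hS => (hC S hS).mono hG) hd

theorem three_mul_maxTri_le (G : SimpleGraph V) : 3 * maxTri G ≤ Nat.card V := by
  obtain ⟨C, hc, hC, hd⟩ := exists_card_eq_maxTri G
  rw [← hc]
  exact three_mul_card_le_of_shortCycleSet hC hd

theorem two_le_maxTri (hS : TriOrQuad G S) (hT : TriOrQuad G T) (hST : Disjoint S T) :
    2 ≤ maxTri G := by
  classical
  have hne := hST.ne hS.nonempty.ne_empty
  rw [← Finset.card_pair hne]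
  refine card_le_maxTri ?_ ?_
  · simp [hS.shortCycleSet, hT.shortCycleSet]
  · simp [Set.pairwise_insert, hST, hST.symm]

theorem three_le_maxTri (hS : TriOrQuad G S) (hT : TriOrQuad G T) (hU : TriOrQuad G U)
    (hST : Disjoint S T) (hSU : Disjoint S U) (hTU : Disjoint T U) : 3 ≤ maxTri G := by
  classical
  have h₁ := hST.ne hS.nonempty.ne_empty
  have h₂ := hSU.ne hS.nonempty.ne_empty
  have h₃ := hTU.ne hT.nonempty.ne_empty
  rw [← Finset.card_eq_three.2 ⟨S, T, U, h₁, h₂, h₃, rfl⟩]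
  refine card_le_maxTri ?_ ?_
  · simp [hS.shortCycleSet, hT.shortCycleSet, hU.shortCycleSet]
  · simp [Set.pairwise_insert, hST, hST.symm, hSU, hSU.symm, hTU, hTU.symm]

end ShortCycles

section OreGraph

variable {V₁ V₂ : Type*} {G₁ : SimpleGraph V₁} {x y : V₁} {G₂ : SimpleGraph V₂} {z : V₂}
  {A : Set V₂}

theorem oreGraph_adj_inl_inl {a b : V₁} : (oreGraph G₁ x y G₂ z A).Adj (.inl a) (.inl b) ↔
    (G₁.deleteEdges {s(x, y)}).Adj a b := by
  simp only [oreGraph, fromRel_adj, deleteEdges_adj, Set.mem_singleton_iff, Sym2.eq_iff]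
  have := G₁.adj_comm a b
  have := fun h : G₁.Adj a b => h.ne
  grind

theorem oreGraph_adj_inr_inr {a b : {v // v ≠ z}} :
    (oreGraph G₁ x y G₂ z A).Adj (.inr a) (.inr b) ↔ G₂.Adj a.1 b.1 := by
  simp only [oreGraph, fromRel_adj]
  have := G₂.adj_comm a b
  have := fun h : G₂.Adj a.1 b.1 => h.ne
  grind

theorem oreGraph_adj_inl_inr {a : V₁} {b : {v // v ≠ z}} :
    (oreGraph G₁ x y G₂ z A).Adj (.inl a) (.inr b) ↔
      G₂.Adj z b.1 ∧ ((a = x ∧ b.1 ∈ A) ∨ (a = y ∧ b.1 ∉ A)) := by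
  simp [oreGraph, fromRel_adj]

theorem oreGraph_adj_inr_inl {a : V₁} {b : {v // v ≠ z}} :
    (oreGraph G₁ x y G₂ z A).Adj (.inr b) (.inl a) ↔
      G₂.Adj z b.1 ∧ ((a = x ∧ b.1 ∈ A) ∨ (a = y ∧ b.1 ∉ A)) := by
  rw [adj_comm, oreGraph_adj_inl_inr]

/-- The vertex `z` of `G` is split into the two nonadjacent vertices `Sum.inl false` and
`Sum.inl true`. -/
abbrev vertexSplit {V : Type*} (G : SimpleGraph V) (z : V) (A : Set V) :
    SimpleGraph (Bool ⊕ {v : V // v ≠ z}) :=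
  oreGraph ⊥ false true G z A

/-- The two vertices resulting from the split are sent to `x` and `y`. -/
def splitMap {W : Type*} (x y : V₁) : Bool ⊕ W → V₁ ⊕ W :=
  Sum.map (fun b => bif b then y else x) id

theorem splitMap_injective {W : Type*} (hxy : x ≠ y) :
    (splitMap (W := W) x y).Injective := by
  refine Sum.map_injective.2 ⟨?_, Function.injective_id⟩
  rintro (_ | _) (_ | _) <;> simp [hxy, hxy.symm]

theorem vertexSplit_adj_splitMap {a b : Bool ⊕ {v : V₂ // v ≠ z}}
    (h : (vertexSplit G₂ z A).Adj a b) :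
    (oreGraph G₁ x y G₂ z A).Adj (splitMap x y a) (splitMap x y b) ∧
      ¬ (a.isLeft ∧ b.isLeft) := by
  rcases a with (_ | _) | a <;> rcases b with (_ | _) | b <;>
    simp_all [splitMap, oreGraph_adj_inl_inl, oreGraph_adj_inr_inr, oreGraph_adj_inl_inr,
      oreGraph_adj_inr_inl]

theorem TriOrQuad.oreGraph_inl {S : Set V₁} (h : TriOrQuad (G₁.deleteEdges {s(x, y)}) S) :
    TriOrQuad (oreGraph G₁ x y G₂ z A) (Sum.inl '' S) :=
  h.image Sum.inl_injective fun _ _ _ _ hab => oreGraph_adj_inl_inl.2 hab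

theorem TriOrQuad.oreGraph_inr {S : Set V₂} (h : TriOrQuad G₂ S) (hz : z ∉ S) :
    TriOrQuad (oreGraph G₁ x y G₂ z A) (Sum.inr '' (Subtype.val ⁻¹' S)) := by
  rcases h with ⟨a, b, c, hab, hbc, hca, rfl⟩ | ⟨a, b, c, d, hac, hbd, hab, hbc, hcd, hda, rfl⟩
  · have ha : a ≠ z := by rintro rfl; simp at hz
    have hb : b ≠ z := by rintro rfl; simp at hz
    have hc : c ≠ z := by rintro rfl; simp at hz
    refine .inl ⟨.inr ⟨a, ha⟩, .inr ⟨b, hb⟩, .inr ⟨c, hc⟩, oreGraph_adj_inr_inr.2 hab,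
      oreGraph_adj_inr_inr.2 hbc, oreGraph_adj_inr_inr.2 hca, ?_⟩
    ext (v | v)
    · simp
    · have := v.2
      simp [Subtype.ext_iff]
      grind
  · have ha : a ≠ z := by rintro rfl; simp at hz
    have hb : b ≠ z := by rintro rfl; simp at hz
    have hc : c ≠ z := by rintro rfl; simp at hz
    have hd : d ≠ z := by rintro rfl; simp at hz
    refine .inr ⟨.inr ⟨a, ha⟩, .inr ⟨b, hb⟩, .inr ⟨c, hc⟩, .inr ⟨d, hd⟩, by simpa using hac,
      by simpa using hbd, oreGraph_adj_inr_inr.2 hab,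
      oreGraph_adj_inr_inr.2 hbc, oreGraph_adj_inr_inr.2 hcd, oreGraph_adj_inr_inr.2 hda, ?_⟩
    ext (v | v)
    · simp
    · have := v.2
      simp [Subtype.ext_iff]
      grind

end OreGraph

/-- The properties of 4-Ore graphs which are carried through Ore compositions: deleting a vertex
leaves a short cycle, splitting a vertex leaves `K₄` minus an edge or two disjoint short cycles
avoiding that vertex, and deleting an edge leaves `K₄` minus an edge or three disjoint short
cycles. -/
structure OreRobust {V : Type*} (G : SimpleGraph V) : Prop where
  avoid : ∀ v, ∃ S, TriOrQuad G S ∧ v ∉ S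
  split : ∀ z A, HasK4MinusE (vertexSplit G z A) ∨
    ∃ S T, TriOrQuad G S ∧ TriOrQuad G T ∧ Disjoint S T ∧ z ∉ S ∧ z ∉ T
  delete : ∀ u v, HasK4MinusE (G.deleteEdges {s(u, v)}) ∨
    ∃ S T U, TriOrQuad (G.deleteEdges {s(u, v)}) S ∧ TriOrQuad (G.deleteEdges {s(u, v)}) T ∧
      TriOrQuad (G.deleteEdges {s(u, v)}) U ∧ Disjoint S T ∧ Disjoint S U ∧ Disjoint T U

namespace OreRobust

variable {V W : Type*} {G : SimpleGraph V} {G' : SimpleGraph W}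

theorem of_iso (h : OreRobust G) (φ : G ≃g G') : OreRobust G' where
  avoid v := by
    obtain ⟨S, hS, hv⟩ := h.avoid (φ.symm v)
    refine ⟨φ '' S, hS.image φ.injective fun a _ b _ => φ.map_adj_iff.2, ?_⟩
    rintro ⟨a, ha, rfl⟩
    simp_all
  split z A := by
    rcases h.split (φ.symm z) (φ ⁻¹' A) with hK | ⟨S, T, hS, hT, hST, hzS, hzT⟩
    · left
      refine hK.map (f := Sum.map id fun v => ⟨φ v.1, fun hv => v.2 (by simp [← hv])⟩) ?_ ?_
      · refine Sum.map_injective.2 ⟨Function.injective_id, fun a b hab => ?_⟩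
        simpa [Subtype.ext_iff] using hab
      · have hadj (b : V) : G.Adj (φ.symm z) b ↔ G'.Adj z (φ b) := by
          rw [← φ.map_adj_iff]; simp
        rintro (a | a) (b | b) <;>
          simp [vertexSplit, oreGraph_adj_inl_inl, oreGraph_adj_inr_inr, oreGraph_adj_inl_inr,
            oreGraph_adj_inr_inl, hadj, φ.map_adj_iff]
    · right
      refine ⟨φ '' S, φ '' T, hS.image φ.injective fun a _ b _ => φ.map_adj_iff.2,
        hT.image φ.injective fun a _ b _ => φ.map_adj_iff.2,
        (Set.disjoint_image_iff φ.injective).2 hST, ?_, ?_⟩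
      · rintro ⟨a, ha, rfl⟩
        simp_all
      · rintro ⟨a, ha, rfl⟩
        simp_all
  delete u v := by
    have hadj (a b : V) (hab : (G.deleteEdges {s(φ.symm u, φ.symm v)}).Adj a b) :
        (G'.deleteEdges {s(u, v)}).Adj (φ a) (φ b) :=
      φ.symm.deleteEdges_adj_symm hab
    rcases h.delete (φ.symm u) (φ.symm v) with hK | ⟨S, T, U, hS, hT, hU, hST, hSU, hTU⟩
    · exact .inl (hK.map φ.injective hadj)
    · exact .inr ⟨φ '' S, φ '' T, φ '' U, hS.image φ.injective fun a _ b _ => hadj a b,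
        hT.image φ.injective fun a _ b _ => hadj a b, hU.image φ.injective fun a _ b _ => hadj a b,
        (Set.disjoint_image_iff φ.injective).2 hST, (Set.disjoint_image_iff φ.injective).2 hSU,
        (Set.disjoint_image_iff φ.injective).2 hTU⟩

theorem exists_deleteEdges (h : OreRobust G) (u v : V) :
    ∃ S, TriOrQuad (G.deleteEdges {s(u, v)}) S := by
  rcases h.delete u v with hK | ⟨S, -, -, hS, -⟩
  · obtain ⟨a, b, c, d, h₁, h₂, h₃, h₄, h₅, h₆, h₇, h₈, h₉, h₁₀, h₁₁⟩ := hK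
    exact ⟨_, .inl ⟨a, b, c, h₇, h₁₀, h₈.symm, rfl⟩⟩
  · exact ⟨S, hS⟩

theorem exists_deleteEdges_deleteEdges (h : OreRobust G) (x y u v : V) :
    ∃ S, TriOrQuad ((G.deleteEdges {s(x, y)}).deleteEdges {s(u, v)}) S := by
  rcases h.delete x y with hK | ⟨S, T, -, hS, hT, -, hST, -⟩
  · exact hK.exists_triOrQuad_deleteEdges u v
  · by_cases hu : u ∈ S
    · exact ⟨T, hT.deleteEdges (Set.disjoint_left.1 hST hu) v⟩
    · exact ⟨S, hS.deleteEdges hu v⟩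

theorem completeGraph_fin_four : OreRobust (⊤ : SimpleGraph (Fin 4)) where
  avoid v := by
    obtain ⟨a, b, c, hab, hbc, hca, ha, hb, hc⟩ : ∃ a b c : Fin 4, a ≠ b ∧ b ≠ c ∧ c ≠ a ∧
        v ≠ a ∧ v ≠ b ∧ v ≠ c := by
      revert v; decide
    exact ⟨_, .inl ⟨a, b, c, hab, hbc, hca, rfl⟩, by simp [ha, hb, hc]⟩
  split z A := by
    left
    obtain ⟨a, b, c, hab, hbc, hca, ha, hb, hc, hA⟩ : ∃ a b c : Fin 4, a ≠ b ∧ b ≠ c ∧ c ≠ a ∧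
        a ≠ z ∧ b ≠ z ∧ c ≠ z ∧ (a ∈ A ↔ b ∈ A) := by
      obtain ⟨a, b, c, hab, hbc, hca, ha, hb, hc⟩ : ∃ a b c : Fin 4, a ≠ b ∧ b ≠ c ∧ c ≠ a ∧
          a ≠ z ∧ b ≠ z ∧ c ≠ z := by
        revert z; decide
      by_cases h₁ : a ∈ A ↔ b ∈ A
      · exact ⟨a, b, c, hab, hbc, hca, ha, hb, hc, h₁⟩
      by_cases h₂ : b ∈ A ↔ c ∈ A
      · exact ⟨b, c, a, hbc, hca, hab, hb, hc, ha, h₂⟩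
      · exact ⟨c, a, b, hca, hab, hbc, hc, ha, hb, by tauto⟩
    obtain ⟨s, hs⟩ : ∃ s : Bool, (s = false ∧ b ∈ A) ∨ (s = true ∧ b ∉ A) := by
      by_cases h : b ∈ A <;> simp [h]
    refine ⟨.inr ⟨a, ha⟩, .inr ⟨b, hb⟩, .inr ⟨c, hc⟩, .inl s, ?_⟩
    simp [vertexSplit, oreGraph_adj_inr_inr, oreGraph_adj_inr_inl, hab, hbc, hca.symm, ha.symm,
      hb.symm, hA, hs]
  delete u v := by
    left
    have : ∃ a b c d : Fin 4, a ≠ b ∧ a ≠ c ∧ a ≠ d ∧ b ≠ c ∧ b ≠ d ∧ c ≠ d ∧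
        s(a, b) ≠ s(u, v) ∧ s(a, c) ≠ s(u, v) ∧ s(a, d) ≠ s(u, v) ∧ s(b, c) ≠ s(u, v) ∧
        s(b, d) ≠ s(u, v) := by
      revert u v; decide
    obtain ⟨a, b, c, d, h⟩ := this
    refine ⟨a, b, c, d, ?_⟩
    simpa only [deleteEdges_adj, top_adj, Set.mem_singleton_iff] using by tauto

theorem oreGraph {G₁ : SimpleGraph V} {G₂ : SimpleGraph W} (h₁ : OreRobust G₁)
    (h₂ : OreRobust G₂) {x y : V} (hxy : x ≠ y) (z : W) (A : Set W) :
    OreRobust (oreGraph G₁ x y G₂ z A) where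
  avoid := by
    rintro (v | v)
    · obtain ⟨S, hS, hz⟩ := h₂.avoid z
      exact ⟨_, hS.oreGraph_inr hz, by simp⟩
    · obtain ⟨S, hS⟩ := h₁.exists_deleteEdges x y
      exact ⟨_, hS.oreGraph_inl, by simp⟩
  split := by
    rintro (w | w) B
    · by_cases hw : w = x ∨ w = y
      · right
        obtain ⟨S, hS, hwS⟩ := h₁.avoid w
        obtain ⟨T, hT, hz⟩ := h₂.avoid z
        have hS' : TriOrQuad (G₁.deleteEdges {s(x, y)}) S := by
          rcases hw with rfl | rfl
          · exact hS.deleteEdges hwS y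
          · rw [Sym2.eq_swap]
            exact hS.deleteEdges hwS x
        exact ⟨_, _, hS'.oreGraph_inl, hT.oreGraph_inr hz, Set.disjoint_image_inl_image_inr,
          by simpa using hwS, by simp⟩
      · push Not at hw
        rcases h₂.split z A with hK | ⟨S, T, hS, hT, hST, hzS, hzT⟩
        · left
          have hne (a) : splitMap x y a ≠ (Sum.inl w : V ⊕ {v : W // v ≠ z}) := by
            rcases a with (_ | _) | a <;> simp [splitMap, hw.1.symm, hw.2.symm]
          refine hK.map (f := fun a => .inr ⟨splitMap x y a, hne a⟩) ?_ ?_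
          · intro a b hab
            simpa [(splitMap_injective hxy).eq_iff] using hab
          · intro a b hab
            exact oreGraph_adj_inr_inr.2 (vertexSplit_adj_splitMap hab).1
        · right
          exact ⟨_, _, hS.oreGraph_inr hzS, hT.oreGraph_inr hzT,
            (Set.disjoint_image_iff Sum.inr_injective).2 (hST.preimage _), by simp, by simp⟩
    · rcases h₁.delete x y with hK | ⟨S, T, -, hS, hT, -, hST, -⟩
      · left
        refine hK.map (f := fun a => .inr ⟨.inl a, by simp⟩) ?_ ?_
        · intro a b hab
          simpa using hab
        · intro a b hab
          exact oreGraph_adj_inr_inr.2 (oreGraph_adj_inl_inl.2 hab)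
      · right
        exact ⟨_, _, hS.oreGraph_inl, hT.oreGraph_inl,
          (Set.disjoint_image_iff Sum.inl_injective).2 hST, by simp, by simp⟩
  delete u v := by
    by_cases huv : u.isLeft ∧ v.isLeft
    · obtain ⟨hu, hv⟩ := huv
      obtain ⟨u, rfl⟩ := Sum.isLeft_iff.1 hu
      obtain ⟨v, rfl⟩ := Sum.isLeft_iff.1 hv
      rcases h₂.split z A with hK | ⟨S, T, hS, hT, hST, hzS, hzT⟩
      · left
        refine hK.map (splitMap_injective hxy) fun a b hab => ?_
        obtain ⟨h, hl⟩ := vertexSplit_adj_splitMap (G₁ := G₁) (x := x) (y := y) hab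
        refine deleteEdges_adj.2 ⟨h, fun he => hl ?_⟩
        rcases a with a | a <;> rcases b with b | b <;> simp_all [splitMap]
      · right
        obtain ⟨U, hU⟩ := h₁.exists_deleteEdges_deleteEdges x y u v
        refine ⟨_, _, Sum.inl '' U, (hS.oreGraph_inr hzS).deleteEdges (by simp) _,
          (hT.oreGraph_inr hzT).deleteEdges (by simp) _,
          hU.image Sum.inl_injective fun a _ b _ hab => ?_,
          (Set.disjoint_image_iff Sum.inr_injective).2 (hST.preimage _),
          Set.disjoint_image_inl_image_inr.symm, Set.disjoint_image_inl_image_inr.symm⟩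
        rw [deleteEdges_adj] at hab ⊢
        exact ⟨oreGraph_adj_inl_inl.2 hab.1, by simpa using hab.2⟩
    · have hadj (a b : V) (hab : (G₁.deleteEdges {s(x, y)}).Adj a b) :
          ((_root_.oreGraph G₁ x y G₂ z A).deleteEdges {s(u, v)}).Adj (.inl a) (.inl b) := by
        refine deleteEdges_adj.2 ⟨oreGraph_adj_inl_inl.2 hab, fun he => huv ?_⟩
        simp only [Set.mem_singleton_iff, Sym2.eq_iff] at he
        rcases he with ⟨rfl, rfl⟩ | ⟨rfl, rfl⟩ <;> simp
      rcases h₁.delete x y with hK | ⟨S, T, U, hS, hT, hU, hST, hSU, hTU⟩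
      · exact .inl (hK.map Sum.inl_injective hadj)
      · exact .inr ⟨_, _, _, hS.image Sum.inl_injective fun a _ b _ => hadj a b,
          hT.image Sum.inl_injective fun a _ b _ => hadj a b,
          hU.image Sum.inl_injective fun a _ b _ => hadj a b,
          (Set.disjoint_image_iff Sum.inl_injective).2 hST,
          (Set.disjoint_image_iff Sum.inl_injective).2 hSU,
          (Set.disjoint_image_iff Sum.inl_injective).2 hTU⟩

end OreRobust

theorem FourOreAux.oreRobust {n : ℕ} {G : SimpleGraph (Fin n)} (h : FourOreAux G) :
    OreRobust G := by
  induction h with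
  | k4 => exact .completeGraph_fin_four
  | ore _ _ h ih₁ ih₂ =>
    obtain ⟨x, y, z, A, hxy, -, -, ⟨φ⟩⟩ := h
    exact (ih₁.oreGraph ih₂ hxy.ne z A).of_iso φ.symm

theorem IsFourOre.oreRobust {V : Type*} {G : SimpleGraph V} (h : IsFourOre G) : OreRobust G := by
  obtain ⟨n, G', hG', ⟨φ⟩⟩ := h
  exact hG'.oreRobust.of_iso φ.symm

theorem IsFourOre.finite {V : Type*} {G : SimpleGraph V} (h : IsFourOre G) : Finite V := by
  obtain ⟨n, G', -, ⟨φ⟩⟩ := h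
  exact .of_equiv _ φ.toEquiv.symm

theorem T8_deleteEdges (u v : Fin 8) : HasK4MinusE (T8.deleteEdges {s(u, v)}) ∨
    ∃ S T, TriOrQuad (T8.deleteEdges {s(u, v)}) S ∧ TriOrQuad (T8.deleteEdges {s(u, v)}) T ∧
      Disjoint S T := by
  by_cases huv : s(6, 7) = s(u, v)
  · right
    refine ⟨{0, 1, 2}, {3, 6, 4, 7}, .inl ⟨0, 1, 2, ?_⟩, .inr ⟨3, 6, 4, 7, ?_⟩, by simp⟩ <;>
      simp [T8, ← huv]
  · left
    have h (c d : Fin 8) (hcd : c ≠ d) (hc : c = 3 ∨ c = 4 ∨ c = 5) (hd : d = 3 ∨ d = 4 ∨ d = 5)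
        (h₁ : s(6, c) ≠ s(u, v)) (h₂ : s(6, d) ≠ s(u, v)) (h₃ : s(7, c) ≠ s(u, v))
        (h₄ : s(7, d) ≠ s(u, v)) : HasK4MinusE (T8.deleteEdges {s(u, v)}) := by
      refine ⟨6, 7, c, d, ?_⟩
      simp only [deleteEdges_adj, Set.mem_singleton_iff, huv, h₁, h₂, h₃, h₄]
      rcases hc with rfl | rfl | rfl <;> rcases hd with rfl | rfl | rfl <;> simp_all [T8]
    by_cases h₃ : s(6, 3) = s(u, v) ∨ s(7, 3) = s(u, v)
    · refine h 4 5 ?_ ?_ ?_ ?_ ?_ ?_ ?_ <;>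
        rcases h₃ with h₃ | h₃ <;> simp [← h₃]
    by_cases h₄ : s(6, 4) = s(u, v) ∨ s(7, 4) = s(u, v)
    · refine h 3 5 ?_ ?_ ?_ ?_ ?_ ?_ ?_ <;>
        rcases h₄ with h₄ | h₄ <;> simp [← h₄]
    · push Not at h₃ h₄
      exact h 3 4 (by simp) (by simp) (by simp) h₃.1 h₄.1 h₃.2 h₄.2

theorem T11_deleteEdges (u v : Fin 11) : HasK4MinusE (T11.deleteEdges {s(u, v)}) := by
  by_cases huv : (u = 6 ∨ u = 7) ∨ (v = 6 ∨ v = 7)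
  · refine ⟨9, 10, 8, 1, ?_⟩
    rcases huv with (rfl | rfl) | (rfl | rfl) <;> simp [T11]
  · push Not at huv
    refine ⟨6, 7, 3, 4, ?_⟩
    simp [T11, huv.1.1.symm, huv.1.2.symm, huv.2.1.symm, huv.2.2.symm]

/-- If `H = T₈`, `T₁₁` or `H` is 4-Ore with `T(H) = 3`, and `f = uv` is an edge of `H`,
then either `T(H - f) = T(H)` or `H - f` contains `K₄` minus an edge as a subgraph. -/
theorem same_T_or_K4_minus_e {V : Type*} (H : SimpleGraph V)
    (hH : Nonempty (H ≃g T8) ∨ Nonempty (H ≃g T11) ∨ (IsFourOre H ∧ maxTri H = 3))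
    (u v : V) (huv : H.Adj u v) :
    maxTri (H.deleteEdges {s(u, v)}) = maxTri H ∨ HasK4MinusE (H.deleteEdges {s(u, v)}) := by
  rcases hH with ⟨⟨φ⟩⟩ | ⟨⟨φ⟩⟩ | ⟨hO, hT⟩
  · have : Finite V := .of_equiv _ φ.toEquiv.symm
    rcases T8_deleteEdges (φ u) (φ v) with hK | ⟨S, T, hS, hT, hST⟩
    · exact .inr (hK.map φ.symm.injective fun _ _ => φ.deleteEdges_adj_symm)
    · left
      have h₁ := two_le_maxTri
        (hS.image φ.symm.injective fun _ _ _ _ => φ.deleteEdges_adj_symm)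
        (hT.image φ.symm.injective fun _ _ _ _ => φ.deleteEdges_adj_symm)
        ((Set.disjoint_image_iff φ.symm.injective).2 hST)
      have h₂ := maxTri_mono (H.deleteEdges_le {s(u, v)})
      have h₃ := three_mul_maxTri_le H
      have h₄ : Nat.card V = 8 := by simp [Nat.card_congr φ.toEquiv]
      omega
  · exact .inr ((T11_deleteEdges (φ u) (φ v)).map φ.symm.injective
      fun _ _ => φ.deleteEdges_adj_symm)
  · have := hO.finite
    rcases hO.oreRobust.delete u v with hK | ⟨S, T, U, hS, hT', hU, hST, hSU, hTU⟩
    · exact .inr hK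
    · exact .inl (le_antisymm (maxTri_mono (H.deleteEdges_le {s(u, v)}))
        (hT ▸ three_le_maxTri hS hT' hU hST hSU hTU))
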